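/- Let r ∈ ℝᵈ and M a closed subgroup of ℝᵈ such that the map κ ↦ κ - r on ℝᵈ/M has equidistributing orbits (true by Weyl's theorem on the closure of the orbit). Then the Cesàro averages (1/N) Σ_{n=1}^{N} u_M(· + κ̌_n), where κ̌_n ∈ ℝᵈ represents -nr mod M, converge weakly as N → ∞ to the Haar measure u_{V̂} on the smallest closed subgroup V̂ of ℝᵈ containing M and r. -/

import Mathlib

open MeasureTheory Filter

namespace CT

lemma finComp {d : ℕ} (μ : Measure (Fin d → ℝ))
    (h : Tendsto (fun R : ℝ =>
        μ (Metric.closedBall 0 R) / volume (Metric.closedBall (0 : Fin d → ℝ) R))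
      atTop (nhds 1)) : IsFiniteMeasureOnCompacts μ := by
  constructor
  intro K hK
  obtain ⟨L, hL⟩ := hK.isBounded.subset_closedBall 0
  have h2 := h.eventually (gt_mem_nhds (by norm_num : (1:ENNReal) < 2))
  obtain ⟨R, hR, hRL, hR0⟩ := (h2.and ((eventually_ge_atTop L).and (eventually_gt_atTop 0))).exists
  refine lt_of_le_of_lt (measure_mono (hL.trans (Metric.closedBall_subset_closedBall hRL))) ?_
  by_contra hc
  have hc : μ (Metric.closedBall 0 R) = ⊤ := by simpa using hc
  rw [hc, ENNReal.top_div_of_ne_top (measure_closedBall_lt_top.ne)] at hR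
  simp at hR

lemma realNorm {d : ℕ} (μ : Measure (Fin d → ℝ))
    (h : Tendsto (fun R : ℝ =>
        μ (Metric.closedBall 0 R) / volume (Metric.closedBall (0 : Fin d → ℝ) R))
      atTop (nhds 1)) :
    Tendsto (fun R : ℝ => μ.real (Metric.closedBall 0 R) / (2 * R) ^ d) atTop (nhds 1) := by
  have h2 := (ENNReal.tendsto_toReal ENNReal.one_ne_top).comp h
  refine (h2.congr' ?_)
  filter_upwards [eventually_gt_atTop 0] with R hR
  simp only [Function.comp, ENNReal.toReal_div, Measure.real]
  rw [Real.volume_pi_closedBall _ hR.le, ENNReal.toReal_ofReal (by positivity)]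
  simp

lemma shiftRatio (d : ℕ) (L : ℝ) :
    Tendsto (fun R : ℝ => (2 * (R + L)) ^ d / (2 * R) ^ d) atTop (nhds 1) := by
  have h1 : Tendsto (fun R : ℝ => (1 + L / R) ^ d) atTop (nhds ((1 + 0) ^ d)) :=
    ((tendsto_const_nhds).add (tendsto_const_nhds.div_atTop tendsto_id)).pow d
  simp only [add_zero, one_pow] at h1
  refine h1.congr' ?_
  filter_upwards [eventually_gt_atTop 0] with R hR
  rw [← div_pow]
  congr 1
  field_simp

lemma shiftNorm {d : ℕ} (μ : Measure (Fin d → ℝ)) (L : ℝ)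
    (h : Tendsto (fun R : ℝ => μ.real (Metric.closedBall 0 R) / (2 * R) ^ d) atTop (nhds 1)) :
    Tendsto (fun R : ℝ => μ.real (Metric.closedBall 0 (R + L)) / (2 * R) ^ d) atTop (nhds 1) := by
  have h1 := (h.comp (tendsto_atTop_add_const_right _ L tendsto_id)).mul (shiftRatio d L)
  simp only [mul_one] at h1
  refine h1.congr' ?_
  filter_upwards [eventually_gt_atTop (-L), eventually_gt_atTop 0] with R hR hR0
  have : 0 < R + L := by linarith
  simp only [Function.comp, id]
  field_simp

lemma volNorm (d : ℕ) :
    Tendsto (fun R : ℝ => (volume : Measure (Fin d → ℝ)).real (Metric.closedBall 0 R) / (2 * R) ^ d)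
      atTop (nhds 1) := by
  apply realNorm
  refine tendsto_const_nhds.congr' ?_
  filter_upwards [eventually_gt_atTop 0] with R hR
  rw [ENNReal.div_self]
  · exact (Metric.measure_closedBall_pos _ _ hR).ne'
  · exact measure_closedBall_lt_top.ne

lemma centreNorm {d : ℕ} (μ : Measure (Fin d → ℝ)) [IsFiniteMeasureOnCompacts μ] (y : Fin d → ℝ)
    (h : Tendsto (fun R : ℝ => μ.real (Metric.closedBall 0 R) / (2 * R) ^ d) atTop (nhds 1)) :
    Tendsto (fun R : ℝ => μ.real (Metric.closedBall y R) / (2 * R) ^ d) atTop (nhds 1) := by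
  refine tendsto_of_tendsto_of_tendsto_of_le_of_le' (shiftNorm μ (-‖y‖) h) (shiftNorm μ (‖y‖) h) ?_ ?_
  · filter_upwards [eventually_gt_atTop 0] with R hR
    gcongr
    · exact measure_closedBall_lt_top.ne
    · apply Metric.closedBall_subset_closedBall'
      simp [dist_eq_norm]
  · filter_upwards [eventually_gt_atTop 0] with R hR
    gcongr
    · exact measure_closedBall_lt_top.ne
    · apply Metric.closedBall_subset_closedBall'
      simp [dist_eq_norm]

/-- uniform bound of ball masses -/
lemma ballBound {d : ℕ} (M : AddSubgroup (Fin d → ℝ)) (μ : Measure (Fin d → ℝ))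
    [IsFiniteMeasureOnCompacts μ]
    (hs : μ ((M : Set (Fin d → ℝ))ᶜ) = 0)
    (hi : ∀ m ∈ M, Measure.map (fun x => x + m) μ = μ) (L : ℝ) (y : Fin d → ℝ) :
    μ.real (Metric.closedBall y L) ≤ μ.real (Metric.closedBall 0 (2 * L)) := by
  by_cases hy : ∃ m ∈ M, m ∈ Metric.closedBall y L
  · obtain ⟨m, hm, hmy⟩ := hy
    have h1 : μ.real (Metric.closedBall m (2 * L)) = μ.real (Metric.closedBall 0 (2 * L)) := by
      unfold Measure.real
      conv_lhs => rw [← hi m hm]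
      rw [Measure.map_apply (by fun_prop) Metric.isClosed_closedBall.measurableSet]
      congr 2
      ext x
      simp [dist_eq_norm]
    rw [← h1]
    apply measureReal_mono _ measure_closedBall_lt_top.ne
    apply Metric.closedBall_subset_closedBall'
    rw [Metric.mem_closedBall, dist_comm] at hmy
    linarith
  · push Not at hy
    have : μ (Metric.closedBall y L) = 0 := by
      apply measure_mono_null _ hs
      intro x hx hxM
      exact hy x hxM hx
    simp [Measure.real, this]

lemma lemmaA {d : ℕ} (M : AddSubgroup (Fin d → ℝ)) (μ ν : Measure (Fin d → ℝ))
    [IsFiniteMeasureOnCompacts μ] [IsFiniteMeasureOnCompacts ν]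
    (hs : μ ((M : Set (Fin d → ℝ))ᶜ) = 0)
    (hi : ∀ m ∈ M, Measure.map (fun x => x + m) ν = ν)
    (h : Tendsto (fun R : ℝ => μ.real (Metric.closedBall 0 R) / (2 * R) ^ d) atTop (nhds 1))
    (f : (Fin d → ℝ) → ℝ) (hf : Continuous f) (hc : HasCompactSupport f) :
    Tendsto (fun R : ℝ => (∫ y in Metric.closedBall 0 R, ∫ x, f (x + y) ∂μ ∂ν) / (2 * R) ^ d)
      atTop (nhds (∫ y, f y ∂ν)) := by
  obtain ⟨L, hL⟩ := hc.isCompact.isBounded.subset_closedBall 0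
  have hfL : ∀ x, L < ‖x‖ → f x = 0 := by
    intro x hx
    by_contra h0
    have := hL (subset_tsupport f h0)
    simp at this; linarith
  obtain ⟨B, hB⟩ := hc.exists_bound_of_continuous hf
  have key : ∀ R : ℝ, (∫ y in Metric.closedBall 0 R, ∫ x, f (x + y) ∂μ ∂ν)
      = ∫ y, f y * μ.real (Metric.closedBall y R) ∂ν := by
    intro R
    have e1 : (∫ y in Metric.closedBall 0 R, ∫ x, f (x + y) ∂μ ∂ν)
        = ∫ y, ∫ x, (Metric.closedBall (0 : Fin d → ℝ) R).indicator 1 y * f (x + y) ∂μ ∂ν := by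
      rw [← integral_indicator Metric.isClosed_closedBall.measurableSet]
      congr 1; ext y
      by_cases hy : y ∈ Metric.closedBall (0 : Fin d → ℝ) R <;> simp only [Set.indicator, hy] <;> simp
    have e2 : (∫ y, ∫ x, (Metric.closedBall (0 : Fin d → ℝ) R).indicator 1 y * f (x + y) ∂μ ∂ν)
        = ∫ x, ∫ y, (Metric.closedBall (0 : Fin d → ℝ) R).indicator 1 y * f (x + y) ∂ν ∂μ := by
      apply integral_integral_swap
      have : IntegrableOn (fun p : (Fin d → ℝ) × (Fin d → ℝ) => 
          (Metric.closedBall (0 : Fin d → ℝ) R).indicator 1 p.1 * f (p.2 + p.1))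
          (Metric.closedBall 0 R ×ˢ Metric.closedBall 0 (R + L)) (ν.prod μ) := by
        refine Measure.integrableOn_of_bounded (M := B) ?_ ?_ ?_
        · exact (((isCompact_closedBall _ _).prod (isCompact_closedBall _ _)).measure_lt_top).ne
        · refine Measurable.aestronglyMeasurable ?_
          refine Measurable.mul ?_ (by fun_prop)
          exact (measurable_one.indicator Metric.isClosed_closedBall.measurableSet).comp measurable_fst
        · refine Eventually.of_forall fun p => ?_
          rw [norm_mul]
          refine le_trans (mul_le_of_le_one_left (norm_nonneg _) ?_) (hB _)
          by_cases hy : p.1 ∈ Metric.closedBall (0 : Fin d → ℝ) R <;> simp only [Set.indicator, hy] <;> simp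
      refine (integrableOn_iff_integrable_of_support_subset ?_).1 this
      rintro ⟨y, x⟩ hp
      simp only [Function.mem_support, Function.uncurry, ne_eq, mul_eq_zero, not_or] at hp
      have hy : y ∈ Metric.closedBall (0 : Fin d → ℝ) R := by
        by_contra hy; exact hp.1 (Set.indicator_of_notMem hy _)
      refine ⟨hy, ?_⟩
      have : ‖x + y‖ ≤ L := by
        by_contra hh; exact hp.2 (hfL _ (not_le.1 hh))
      simp only [mem_closedBall_zero_iff] at hy ⊢
      have := norm_sub_le (x + y) y
      simp only [add_sub_cancel_right] at this
      linarith
    have e3 : (∫ x, ∫ y, (Metric.closedBall (0 : Fin d → ℝ) R).indicator 1 y * f (x + y) ∂ν ∂μ)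
        = ∫ x, ∫ y, (Metric.closedBall (0 : Fin d → ℝ) R).indicator 1 (y - x) * f y ∂ν ∂μ := by
      apply integral_congr_ae
      have : ∀ᵐ x ∂μ, x ∈ M := hs
      filter_upwards [this] with x hx
      conv_rhs => rw [← hi x hx]
      rw [integral_map (by fun_prop)]
      · simp [add_comm]
      · refine Measurable.aestronglyMeasurable ?_
        refine Measurable.mul ?_ (by fun_prop)
        exact (measurable_one.indicator Metric.isClosed_closedBall.measurableSet).comp (by fun_prop)
    have e4 : (∫ x, ∫ y, (Metric.closedBall (0 : Fin d → ℝ) R).indicator 1 (y - x) * f y ∂ν ∂μ)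
       = ∫ y, ∫ x, (Metric.closedBall (0 : Fin d → ℝ) R).indicator 1 (y - x) * f y ∂μ ∂ν := by
      apply integral_integral_swap
      have : IntegrableOn (fun p : (Fin d → ℝ) × (Fin d → ℝ) => 
          (Metric.closedBall (0 : Fin d → ℝ) R).indicator 1 (p.2 - p.1) * f p.2)
          (Metric.closedBall 0 (R + L) ×ˢ Metric.closedBall 0 L) (μ.prod ν) := by
        refine Measure.integrableOn_of_bounded (M := B) ?_ ?_ ?_
        · exact (((isCompact_closedBall _ _).prod (isCompact_closedBall _ _)).measure_lt_top).ne
        · refine Measurable.aestronglyMeasurable ?_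
          refine Measurable.mul ?_ (by fun_prop)
          exact (measurable_one.indicator Metric.isClosed_closedBall.measurableSet).comp 
            (measurable_snd.sub measurable_fst)
        · refine Eventually.of_forall fun p => ?_
          rw [norm_mul]
          refine le_trans (mul_le_of_le_one_left (norm_nonneg _) ?_) (hB _)
          by_cases hy : p.2 - p.1 ∈ Metric.closedBall (0 : Fin d → ℝ) R <;> simp only [Set.indicator, hy] <;> simp
      refine (integrableOn_iff_integrable_of_support_subset ?_).1 this
      rintro ⟨x, y⟩ hp
      simp only [Function.mem_support, Function.uncurry, ne_eq, mul_eq_zero, not_or] at hp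
      have hy : y - x ∈ Metric.closedBall (0 : Fin d → ℝ) R := by
        by_contra hy; exact hp.1 (Set.indicator_of_notMem hy _)
      have h2 : ‖y‖ ≤ L := by
        by_contra hh; exact hp.2 (hfL _ (not_le.1 hh))
      refine ⟨?_, by simpa using h2⟩
      simp only [mem_closedBall_zero_iff] at hy ⊢
      have := norm_sub_le y (y - x)
      simp only [sub_sub_cancel] at this
      linarith
    rw [e1, e2, e3, e4]
    congr 1; ext y
    rw [integral_mul_const, mul_comm]
    congr 1
    have : (fun x => (Metric.closedBall (0 : Fin d → ℝ) R).indicator (1 : (Fin d → ℝ) → ℝ) (y - x))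
        = (Metric.closedBall y R).indicator 1 := by
      ext x
      have : y - x ∈ Metric.closedBall (0 : Fin d → ℝ) R ↔ x ∈ Metric.closedBall y R := by
        simp [dist_eq_norm, norm_sub_rev]
      by_cases hx : x ∈ Metric.closedBall y R
      · rw [Set.indicator_of_mem hx, Set.indicator_of_mem (this.2 hx)]; rfl
      · rw [Set.indicator_of_notMem hx, Set.indicator_of_notMem (fun h => hx (this.1 h))]
    rw [this, integral_indicator_one Metric.isClosed_closedBall.measurableSet]
  simp_rw [key, ← integral_div]
  refine tendsto_integral_filter_of_dominated_convergence (fun y => ‖f y‖ * 2) ?_ ?_ ?_ ?_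
  · filter_upwards [eventually_gt_atTop 0] with R hR
    have hm : Measurable (fun y => μ (Metric.closedBall y R)) := by
      have := measurable_measure_prodMk_left (ν := μ) 
        (s := {p : (Fin d → ℝ) × (Fin d → ℝ) | dist p.2 p.1 ≤ R}) 
        (isClosed_le (by fun_prop) (by fun_prop)).measurableSet
      exact this
    exact ((hf.measurable.mul hm.ennreal_toReal).div_const _).aestronglyMeasurable
  · filter_upwards [eventually_gt_atTop 0,
      (shiftNorm μ L h).eventually (gt_mem_nhds (by norm_num : (1:ℝ) < 2))] with R hR h2
    refine Eventually.of_forall fun y => ?_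
    by_cases hy : L < ‖y‖
    · simp [hfL y hy]
    rw [mul_div_assoc, norm_mul]
    gcongr
    rw [Real.norm_of_nonneg (by positivity)]
    refine le_trans ?_ h2.le
    gcongr
    · exact measure_closedBall_lt_top.ne
    · apply Metric.closedBall_subset_closedBall'
      simp [dist_eq_norm]; linarith
  · exact (hf.integrable_of_hasCompactSupport hc).norm.mul_const _
  · refine Eventually.of_forall fun y => ?_
    have := (centreNorm μ y h).const_mul (f y)
    simpa [mul_div_assoc] using this

lemma intBound {d : ℕ} (μ : Measure (Fin d → ℝ)) [IsFiniteMeasureOnCompacts μ]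
    (g : (Fin d → ℝ) → ℝ) (b : ℝ) (y : Fin d → ℝ) (L : ℝ) (hb : ∀ x, ‖g x‖ ≤ b)
    (h0 : ∀ x, x ∉ Metric.closedBall y L → g x = 0) :
    |∫ x, g x ∂μ| ≤ b * μ.real (Metric.closedBall y L) := by
  rw [← setIntegral_eq_integral_of_forall_compl_eq_zero h0, ← Real.norm_eq_abs]
  exact norm_setIntegral_le_of_norm_le_const measure_closedBall_lt_top (fun x _ => hb x)

lemma suppBall {d : ℕ} (f : (Fin d → ℝ) → ℝ) (hc : HasCompactSupport f) :
    ∃ L : ℝ, 0 ≤ L ∧ ∀ x, L < ‖x‖ → f x = 0 := by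
  obtain ⟨L, hL⟩ := hc.isCompact.isBounded.subset_closedBall 0
  refine ⟨max L 0, le_max_right _ _, ?_⟩
  intro x hx
  by_contra h0
  have := hL (subset_tsupport f h0)
  simp at this hx; linarith

lemma phiBound {d : ℕ} (M : AddSubgroup (Fin d → ℝ)) (μ : Measure (Fin d → ℝ))
    [IsFiniteMeasureOnCompacts μ]
    (hs : μ ((M : Set (Fin d → ℝ))ᶜ) = 0)
    (hi : ∀ m ∈ M, Measure.map (fun x => x + m) μ = μ)
    (f : (Fin d → ℝ) → ℝ) (hf : Continuous f) (hc : HasCompactSupport f) :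
    ∃ C : ℝ, 0 ≤ C ∧ ∀ y, |∫ x, f (x + y) ∂μ| ≤ C := by
  obtain ⟨L, hL0, hL⟩ := suppBall f hc
  obtain ⟨B, hB⟩ := hc.exists_bound_of_continuous hf
  have hB0 : 0 ≤ B := (norm_nonneg _).trans (hB 0)
  refine ⟨B * μ.real (Metric.closedBall 0 (2 * L)), by positivity, fun y => ?_⟩
  refine (intBound μ _ B (-y) L (fun x => hB _) ?_).trans ?_
  · intro x hx
    apply hL
    simpa [dist_eq_norm] using hx
  · exact mul_le_mul_of_nonneg_left (ballBound M μ hs hi L _) hB0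

lemma phiUC {d : ℕ} (M : AddSubgroup (Fin d → ℝ)) (μ : Measure (Fin d → ℝ))
    [IsFiniteMeasureOnCompacts μ]
    (hs : μ ((M : Set (Fin d → ℝ))ᶜ) = 0)
    (hi : ∀ m ∈ M, Measure.map (fun x => x + m) μ = μ)
    (f : (Fin d → ℝ) → ℝ) (hf : Continuous f) (hc : HasCompactSupport f) (ε : ℝ) (hε : 0 < ε) :
    ∃ δ > 0, ∀ y e : Fin d → ℝ, ‖e‖ < δ →
      |(∫ x, f (x + (y + e)) ∂μ) - ∫ x, f (x + y) ∂μ| ≤ ε := by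
  obtain ⟨L, hL0, hL⟩ := suppBall f hc
  set K := μ.real (Metric.closedBall 0 (2 * (L + 1)))
  have hK : 0 ≤ K := measureReal_nonneg
  have huc := hc.uniformContinuous_of_continuous hf
  obtain ⟨δ, hδ, hd⟩ := Metric.uniformContinuous_iff.1 huc (ε / (K + 1)) (by positivity)
  refine ⟨min δ 1, by positivity, fun y e he => ?_⟩
  have hint : ∀ z, Integrable (fun x => f (x + z)) μ := fun z =>
    (hf.comp (continuous_add_const z)).integrable_of_hasCompactSupport
      (hc.comp_homeomorph (Homeomorph.addRight z))
  rw [← integral_sub (hint _) (hint _)]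
  refine (intBound μ _ (ε / (K + 1)) (-y) (L + 1) (fun x => ?_) ?_).trans ?_
  · have := @hd (x + (y + e)) (x + y) (by
      simp [dist_eq_norm]; exact he.trans_le (min_le_left _ _))
    rw [dist_eq_norm] at this
    exact this.le
  · intro x hx
    have hx : L + 1 < ‖x + y‖ := by simpa [dist_eq_norm] using hx
    have h1 : ‖e‖ < 1 := he.trans_le (min_le_right _ _)
    rw [hL (x + y) (by linarith), hL, sub_zero]
    have := norm_sub_le (x + (y + e)) e
    rw [← add_assoc, add_sub_cancel_right] at this
    rw [← add_assoc]
    linarith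
  · calc _ ≤ ε / (K + 1) * K := by gcongr; exact ballBound M μ hs hi _ _
      _ ≤ ε := by rw [div_mul_eq_mul_div, div_le_iff₀ (by positivity)]; nlinarith

lemma phiCont {d : ℕ} (M : AddSubgroup (Fin d → ℝ)) (μ : Measure (Fin d → ℝ))
    [IsFiniteMeasureOnCompacts μ]
    (hs : μ ((M : Set (Fin d → ℝ))ᶜ) = 0)
    (hi : ∀ m ∈ M, Measure.map (fun x => x + m) μ = μ)
    (f : (Fin d → ℝ) → ℝ) (hf : Continuous f) (hc : HasCompactSupport f) :
    Continuous (fun y => ∫ x, f (x + y) ∂μ) := by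
  rw [Metric.continuous_iff]
  intro b ε hε
  obtain ⟨δ, hδ, h⟩ := phiUC M μ hs hi f hf hc (ε / 2) (by positivity)
  refine ⟨δ, hδ, fun a ha => ?_⟩
  have := h b (a - b) (by simpa [dist_eq_norm] using ha)
  rw [add_sub_cancel] at this
  rw [Real.dist_eq]
  linarith

lemma phiInv {d : ℕ} (M : AddSubgroup (Fin d → ℝ)) (μ : Measure (Fin d → ℝ))
    (hi : ∀ m ∈ M, Measure.map (fun x => x + m) μ = μ)
    (f : (Fin d → ℝ) → ℝ) (hf : Continuous f) (m : Fin d → ℝ) (hm : m ∈ M) (y : Fin d → ℝ) :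
    ∫ x, f (x + (m + y)) ∂μ = ∫ x, f (x + y) ∂μ := by
  conv_rhs => rw [← hi m hm]
  rw [integral_map (by fun_prop) (by fun_prop)]
  simp [add_assoc]

lemma packing {d : ℕ} (M : AddSubgroup (Fin d → ℝ)) (μ : Measure (Fin d → ℝ))
    [IsFiniteMeasureOnCompacts μ]
    (hs : μ ((M : Set (Fin d → ℝ))ᶜ) = 0)
    (hi : ∀ m ∈ M, Measure.map (fun x => x + m) μ = μ)
    (h : Tendsto (fun R : ℝ => μ.real (Metric.closedBall 0 R) / (2 * R) ^ d) atTop (nhds 1))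
    (δ : ℝ) (hδ : 0 < δ) :
    ∃ n : ℕ, ∀ S : Finset (Fin d → ℝ),
      (∀ a ∈ S, ∀ b ∈ S, a ≠ b → ∀ m ∈ M, δ ≤ ‖a - b - m‖) → S.card < n := by
  set f : (Fin d → ℝ) → ℝ := fun x => max 0 (δ / 2 - ‖x‖) with hfdef
  have hf : Continuous f := by fun_prop
  have hf0 : ∀ x, 0 ≤ f x := fun x => le_max_left _ _
  have hfs : ∀ x, f x ≠ 0 → ‖x‖ < δ / 2 := by
    intro x hx
    by_contra hh
    exact hx (max_eq_left (by linarith))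
  have hc : HasCompactSupport f := by
    refine HasCompactSupport.intro (isCompact_closedBall 0 (δ / 2)) ?_
    intro x hx
    by_contra hh
    exact hx (by simpa using (hfs x hh).le)
  have hI : 0 < ∫ y, f y := by
    refine hf.integral_pos_of_hasCompactSupport_nonneg_nonzero hc hf0 (x := 0) ?_
    simp [hfdef]; linarith
  obtain ⟨C, hC0, hC⟩ := phiBound M μ hs hi f hf hc
  obtain ⟨n, hn⟩ := exists_nat_gt (C / ∫ y, f y)
  refine ⟨n, fun S hS => ?_⟩
  have hpc := phiCont M μ hs hi f hf hc
  have hφ0 : ∀ y, (∫ x, f (x + y) ∂μ) ≠ 0 → ∃ x ∈ M, ‖x + y‖ < δ / 2 := by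
    intro y hy
    by_contra hh
    push Not at hh
    apply hy
    apply integral_eq_zero_of_ae
    have : ∀ᵐ x ∂μ, x ∈ M := hs
    filter_upwards [this] with x hx
    by_contra h0
    have := hfs _ h0
    have := hh x hx
    linarith
  have hsum : ∀ y, ∑ a ∈ S, ∫ x, f (x + (y - a)) ∂μ ≤ C := by
    intro y
    by_cases hex : ∃ a ∈ S, (∫ x, f (x + (y - a)) ∂μ) ≠ 0
    · obtain ⟨a, ha, hane⟩ := hex
      rw [Finset.sum_eq_single_of_mem a ha]
      · exact (le_abs_self _).trans (hC _)
      · intro b hb hba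
        by_contra hbne
        obtain ⟨x, hx, hx2⟩ := hφ0 _ hane
        obtain ⟨x', hx', hx2'⟩ := hφ0 _ hbne
        have h1 := hS a ha b hb (Ne.symm hba) (x - x') (M.sub_mem hx hx')
        have h2 := norm_sub_le (x' + (y - b)) (x + (y - a))
        have : x' + (y - b) - (x + (y - a)) = a - b - (x - x') := by abel
        rw [this] at h2
        linarith
    · push Not at hex
      rw [Finset.sum_eq_zero hex]; exact hC0
  have hlim : Tendsto (fun R : ℝ => (∫ y in Metric.closedBall (0 : Fin d → ℝ) R, 
      ∑ a ∈ S, ∫ x, f (x + (y - a)) ∂μ) / (2 * R) ^ d)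
      atTop (nhds (∑ a ∈ S, ∫ y, f y)) := by
    have := tendsto_finsetSum S (fun a _ => lemmaA M μ volume hs 
      (fun m _ => map_add_right_eq_self _ m) h (fun x => f (x - a)) (by fun_prop) 
      (hc.comp_homeomorph (Homeomorph.subRight a)))
    simp only [integral_sub_right_eq_self] at this
    refine this.congr fun R => ?_
    rw [← Finset.sum_div, integral_finsetSum]
    · simp only [add_sub_assoc]
    · intro a _
      exact ((hpc.comp (continuous_sub_right a)).continuousOn.integrableOn_compact 
        (isCompact_closedBall _ _))
  have hlim2 := (volNorm d).const_mul C
  have hle := le_of_tendsto_of_tendsto hlim hlim2 (by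
    filter_upwards [eventually_gt_atTop 0] with R hR
    rw [← mul_div_assoc]
    gcongr
    calc _ ≤ ∫ y in Metric.closedBall (0 : Fin d → ℝ) R, C := by
          refine integral_mono ?_ ?_ hsum
          · refine ContinuousOn.integrableOn_compact (isCompact_closedBall _ _) ?_
            refine Continuous.continuousOn ?_
            exact continuous_finsetSum _ fun a _ => hpc.comp (continuous_sub_right a)
          · exact integrableOn_const measure_closedBall_lt_top.ne
      _ = _ := by simp [mul_comm])
  simp only [Finset.sum_const, nsmul_eq_mul, mul_one] at hle
  have : (S.card : ℝ) ≤ C / ∫ y, f y := by rwa [le_div_iff₀ hI]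
  exact_mod_cast this.trans_lt hn

lemma net {d : ℕ} (M : AddSubgroup (Fin d → ℝ)) (μ : Measure (Fin d → ℝ))
    [IsFiniteMeasureOnCompacts μ]
    (hs : μ ((M : Set (Fin d → ℝ))ᶜ) = 0)
    (hi : ∀ m ∈ M, Measure.map (fun x => x + m) μ = μ)
    (h : Tendsto (fun R : ℝ => μ.real (Metric.closedBall 0 R) / (2 * R) ^ d) atTop (nhds 1))
    (δ : ℝ) (hδ : 0 < δ) (P : Set (Fin d → ℝ)) :
    ∃ S : Finset (Fin d → ℝ), (∀ s ∈ S, s ∈ P) ∧ 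
      ∀ p ∈ P, ∃ s ∈ S, ∃ m ∈ M, ‖p - s - m‖ < δ := by
  obtain ⟨n, hn⟩ := packing M μ hs hi h δ hδ
  by_contra hcon
  push Not at hcon
  have : ∀ k : ℕ, ∃ S : Finset (Fin d → ℝ), (∀ s ∈ S, s ∈ P) ∧ 
      (∀ a ∈ S, ∀ b ∈ S, a ≠ b → ∀ m ∈ M, δ ≤ ‖a - b - m‖) ∧ S.card = k := by
    intro k
    induction k with
    | zero => exact ⟨∅, by simp⟩
    | succ k ih =>
      obtain ⟨S, hSP, hS, hk⟩ := ih
      obtain ⟨p, hp, hps⟩ := hcon S hSP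
      have hpS : p ∉ S := fun hpS => by
        have := hps p hpS 0 M.zero_mem
        simp at this; linarith
      refine ⟨insert p S, ?_, ?_, by rw [Finset.card_insert_of_notMem hpS, hk]⟩
      · intro s hs
        rcases Finset.mem_insert.1 hs with rfl | hs
        · exact hp
        · exact hSP s hs
      · intro a ha b hb hab m hm
        rcases Finset.mem_insert.1 ha with rfl | ha2 <;> rcases Finset.mem_insert.1 hb with rfl | hb2
        · exact absurd rfl hab
        · exact hps b hb2 m hm
        · have := hps a ha2 (-m) (M.neg_mem hm)
          rw [← norm_neg] at this
          have e : a - b - m = -(b - a - -m) := by abel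
          rwa [e]
        · exact hS a ha2 b hb2 hab m hm
  obtain ⟨S, _, hS, hk⟩ := this n
  have := hn S hS
  omega

lemma telescope (a : ℤ → ℝ) (C : ℝ) (hC : ∀ k, |a k| ≤ C) (s : ℤ) :
    Tendsto (fun N : ℕ => (1 / (N : ℝ)) * ∑ n ∈ Finset.Icc 1 N, a (s - n)
      - (1 / (N : ℝ)) * ∑ n ∈ Finset.Icc 1 N, a (-n)) atTop (nhds 0) := by
  have step : ∀ s : ℤ, Tendsto (fun N : ℕ => (1 / (N : ℝ)) * ∑ n ∈ Finset.Icc 1 N, a (s + 1 - n)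
      - (1 / (N : ℝ)) * ∑ n ∈ Finset.Icc 1 N, a (s - n)) atTop (nhds 0) := by
    intro s
    have hN : ∀ N : ℕ, ∑ n ∈ Finset.Icc 1 N, a (s + 1 - n) - ∑ n ∈ Finset.Icc 1 N, a (s - n)
        = a s - a (s - N) := by
      intro N
      induction N with
      | zero => simp
      | succ N ih =>
        rw [Finset.sum_Icc_succ_top (by omega), Finset.sum_Icc_succ_top (by omega)]
        have : s + 1 - ((N + 1 : ℕ) : ℤ) = s - N := by push_cast; ring
        rw [this]
        linarith
    have h0 : Tendsto (fun N : ℕ => (1 / (N : ℝ)) * (2 * C)) atTop (nhds 0) := by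
      simpa using tendsto_one_div_atTop_nhds_zero_nat.mul_const (2 * C)
    refine squeeze_zero_norm (fun N => ?_) h0
    rw [← mul_sub, hN, norm_mul, Real.norm_of_nonneg (by positivity)]
    gcongr
    have h1 := abs_sub (a s) (a (s - N))
    have h2 := hC s
    have h3 := hC (s - N)
    rw [Real.norm_eq_abs]
    linarith
  induction s using Int.induction_on with
  | zero => simp
  | succ k ih => simpa using (step k).add ih
  | pred k ih =>
    have := ih.sub (step (-k - 1))
    simpa using this

end CT



/-- Weyl-type Cesàro convergence: the averages `(1/N) Σ_{n=1}^{N} u_M(· + κ̌_n)`,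
where `κ̌_n` represents `-nr mod M`, converge weakly (tested against continuous
compactly supported functions) to the Haar measure `u_V̂` on the smallest closed
subgroup `V̂` of `ℝᵈ` containing `M` and `r`. -/
theorem cesaro_translates_haar_converge
    (d : ℕ) (M : AddSubgroup (Fin d → ℝ)) (hMcl : IsClosed (M : Set (Fin d → ℝ)))
    (r : Fin d → ℝ)
    (V : AddSubgroup (Fin d → ℝ))
    (hV : V = (M ⊔ AddSubgroup.closure {r}).topologicalClosure)
    (uM uV : Measure (Fin d → ℝ))
    -- u_M is a Haar measure on M:
    (huMsupp : uM ((M : Set (Fin d → ℝ))ᶜ) = 0)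
    (huMinv : ∀ m ∈ M, Measure.map (fun x => x + m) uM = uM)
    (huMnorm : Tendsto (fun R : ℝ =>
        uM (Metric.closedBall 0 R) / volume (Metric.closedBall (0 : Fin d → ℝ) R))
      atTop (nhds 1))
    -- u_V̂ is a Haar measure on V̂:
    (huVsupp : uV ((V : Set (Fin d → ℝ))ᶜ) = 0)
    (huVinv : ∀ v ∈ V, Measure.map (fun x => x + v) uV = uV)
    (huVnorm : Tendsto (fun R : ℝ =>
        uV (Metric.closedBall 0 R) / volume (Metric.closedBall (0 : Fin d → ℝ) R))
      atTop (nhds 1))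
    -- κ̌_n is a representative of -n r modulo M:
    (κ : ℕ → (Fin d → ℝ)) (hκ : ∀ n : ℕ, κ n + n • r ∈ M) :
    ∀ f : (Fin d → ℝ) → ℝ, Continuous f → HasCompactSupport f →
      Tendsto (fun N : ℕ =>
          (1 / (N : ℝ)) * ∑ n ∈ Finset.Icc 1 N, ∫ x, f (x + κ n) ∂uM)
        atTop (nhds (∫ x, f x ∂uV)) := by
  intro f hf hc
  haveI := CT.finComp uM huMnorm
  haveI := CT.finComp uV huVnorm
  have hM := CT.realNorm uM huMnorm
  have hVn := CT.realNorm uV huVnorm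
  have hMV : ∀ m ∈ M, m ∈ V := fun m hm => by
    rw [hV]; exact AddSubgroup.le_topologicalClosure _ (AddSubgroup.mem_sup_left hm)
  have hrV : r ∈ V := by
    rw [hV]
    exact AddSubgroup.le_topologicalClosure _
      (AddSubgroup.mem_sup_right (AddSubgroup.subset_closure rfl))
  set φ : (Fin d → ℝ) → ℝ := fun y => ∫ x, f (x + y) ∂uM with hφ
  have hφκ : ∀ n : ℕ, ∫ x, f (x + κ n) ∂uM = φ (-((n : ℤ) • r)) := by
    intro n
    have := CT.phiInv M uM huMinv f hf _ (hκ n) (-((n : ℤ) • r))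
    simp only [natCast_zsmul, add_neg_cancel_right] at this
    simpa [hφ] using this
  simp only [hφκ]
  have hpc : Continuous φ := CT.phiCont M uM huMsupp huMinv f hf hc
  obtain ⟨C, hC0, hC⟩ := CT.phiBound M uM huMsupp huMinv f hf hc
  set A : ℕ → (Fin d → ℝ) → ℝ := fun N y =>
    (1 / (N : ℝ)) * ∑ n ∈ Finset.Icc 1 N, φ (y - (n : ℤ) • r) with hA
  have hA0 : ∀ N : ℕ, (1 / (N : ℝ)) * ∑ n ∈ Finset.Icc 1 N, φ (-((n : ℤ) • r)) = A N 0 := by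
    intro N; simp [hA]
  simp only [hA0]
  have hAc : ∀ N, Continuous (A N) := fun N =>
    continuous_const.mul (continuous_finsetSum _ fun n _ => hpc.comp (continuous_id.sub continuous_const))
  -- averages of `A N` over large balls
  have hAlim : ∀ N : ℕ, 0 < N → Tendsto (fun R : ℝ => 
      (∫ y in Metric.closedBall 0 R, A N y ∂uV) / (2 * R) ^ d) atTop (nhds (∫ x, f x ∂uV)) := by
    intro N hN
    have h1 : ∀ n : ℕ, Tendsto (fun R : ℝ =>
        (∫ y in Metric.closedBall 0 R, φ (y - (n : ℤ) • r) ∂uV) / (2 * R) ^ d)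
        atTop (nhds (∫ x, f x ∂uV)) := by
      intro n
      have h2 := CT.lemmaA M uM uV huMsupp (fun m hm => huVinv m (hMV m hm)) hM
        (fun x => f (x - (n : ℤ) • r)) (by fun_prop)
        (hc.comp_homeomorph (Homeomorph.subRight ((n : ℤ) • r)))
      have h3 : ∫ x, f (x - (n : ℤ) • r) ∂uV = ∫ x, f x ∂uV := by
        conv_lhs => rw [← huVinv ((n : ℤ) • r) (V.zsmul_mem hrV _)]
        rw [integral_map (by fun_prop) (by fun_prop)]
        simp
      rw [h3] at h2
      simpa only [hφ, add_sub_assoc] using h2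
    have h4 := (tendsto_finsetSum (Finset.Icc 1 N) (fun n _ => h1 n)).const_mul (1 / (N : ℝ))
    have h5 : (1 / (N : ℝ)) * ∑ n ∈ Finset.Icc 1 N, ∫ x, f x ∂uV = ∫ x, f x ∂uV := by
      have : (N : ℝ) ≠ 0 := by positivity
      simp
      field_simp
    rw [h5] at h4
    refine h4.congr fun R => ?_
    rw [← Finset.sum_div, ← mul_div_assoc, hA, integral_const_mul, integral_finsetSum]
    intro n _
    exact ((hpc.comp (continuous_id.sub continuous_const)).continuousOn.integrableOn_compact
      (isCompact_closedBall _ _))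
  -- uniform closeness on `V`
  have hunif : ∀ ε > 0, ∀ᶠ N : ℕ in atTop, ∀ y ∈ V, |A N y - A N 0| ≤ ε := by
    intro ε hε
    obtain ⟨δ, hδ, hu⟩ := CT.phiUC M uM huMsupp huMinv f hf hc (ε / 2) (by positivity)
    obtain ⟨S, hSP, hS⟩ := CT.net M uM huMsupp huMinv hM (δ / 2) (by positivity)
      (Set.range fun k : ℤ => k • r)
    have hev : ∀ᶠ N : ℕ in atTop, ∀ s ∈ S, |A N s - A N 0| ≤ ε / 2 := by
      rw [Filter.eventually_all_finset]
      intro s hs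
      obtain ⟨k, rfl⟩ := hSP s hs
      have h1 := CT.telescope (fun k => φ (k • r)) C (fun k => hC _) k
      have h2 := (h1.abs).eventually (gt_mem_nhds (by simpa using half_pos hε : |(0:ℝ)| < ε / 2))
      filter_upwards [h2] with N hN
      simpa [hA, sub_smul, neg_smul] using hN.le
    filter_upwards [hev, eventually_gt_atTop 0] with N hN hN0 y hy
    have hy2 : y ∈ closure ((M ⊔ AddSubgroup.closure {r} : AddSubgroup (Fin d → ℝ)) : Set (Fin d → ℝ)) := by
      rw [hV] at hy; exact hy
    obtain ⟨g, hg, hyg⟩ := Metric.mem_closure_iff.1 hy2 (δ / 2) (by positivity)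
    obtain ⟨m, hm, z, hz, rfl⟩ := AddSubgroup.mem_sup.1 hg
    obtain ⟨k, rfl⟩ := AddSubgroup.mem_closure_singleton.1 hz
    obtain ⟨s, hsS, m', hm', hsm⟩ := hS _ ⟨k, rfl⟩
    simp only at hsm
    have hAe : |A N y - A N s| ≤ ε / 2 := by
      have he : ∀ n : ℕ, |φ (y - (n : ℤ) • r) - φ (s - (n : ℤ) • r)| ≤ ε / 2 := by
        intro n
        have h1 := hu (s - (n : ℤ) • r) (y - (m + k • r) + (k • r - s - m')) (by
          refine (norm_add_le _ _).trans_lt ?_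
          rw [dist_eq_norm] at hyg
          linarith)
        have h2 := CT.phiInv M uM huMinv f hf (m + m') (M.add_mem hm hm')
          (s - (n : ℤ) • r + (y - (m + k • r) + (k • r - s - m')))
        have h3 : (m + m') + (s - (n : ℤ) • r + (y - (m + k • r) + (k • r - s - m')))
            = y - (n : ℤ) • r := by abel
        rw [h3] at h2
        rw [← h2] at h1
        exact h1
      simp only [hA]
      rw [← mul_sub, ← Finset.sum_sub_distrib, abs_mul, abs_of_nonneg (by positivity)]
      have hNp : (0 : ℝ) < N := by exact_mod_cast hN0
      calc _ ≤ (1 / (N : ℝ)) * ∑ n ∈ Finset.Icc 1 N, (ε / 2) := by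
            gcongr
            exact (Finset.abs_sum_le_sum_abs _ _).trans (Finset.sum_le_sum fun n _ => he n)
        _ = ε / 2 := by
            simp
            field_simp
    have h1 := abs_sub_le (A N y) (A N s) (A N 0)
    have h2 := hN s hsS
    linarith
  rw [Metric.tendsto_nhds]
  intro ε hε
  filter_upwards [hunif (ε / 2) (by positivity), eventually_gt_atTop 0] with N hN hN0
  have hl := (hAlim N hN0).sub (hVn.const_mul (A N 0))
  rw [mul_one] at hl
  have hle := le_of_tendsto_of_tendsto hl.abs (hVn.const_mul (ε / 2)) (by
    filter_upwards [eventually_gt_atTop 0] with R hR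
    have hK : uV (Metric.closedBall (0 : Fin d → ℝ) R) < ⊤ := measure_closedBall_lt_top
    have e1 : A N 0 * uV.real (Metric.closedBall 0 R) 
        = ∫ y in Metric.closedBall 0 R, A N 0 ∂uV := by simp [mul_comm]
    rw [← mul_div_assoc, ← mul_div_assoc, ← sub_div, abs_div, abs_of_pos (by positivity : 0 < (2 * R) ^ d), e1,
      ← integral_sub ((hAc N).continuousOn.integrableOn_compact (isCompact_closedBall _ _))
        (integrableOn_const hK.ne), ← Real.norm_eq_abs]
    gcongr
    refine norm_setIntegral_le_of_norm_le_const_ae hK ?_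
    have : ∀ᵐ x ∂uV, x ∈ V := huVsupp
    filter_upwards [ae_restrict_of_ae this] with x hx
    exact hN x hx)
  rw [Real.dist_eq, abs_sub_comm]
  linarith
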